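/- Let g ∈ S(ℝ^d)\{0}, m ∈ ℝ, σ ∈ S^m(ℝ^{2d}). Then for every n ∈ ℕ there is a constant C > 0, independent of σ, such that the Born–Jordan operator satisfies |⟨Op_{BJ}(σ)π(z)g, π(u)g⟩| ≤ C |σ|_{n+⌈|m|⌉+2d+1, m} ⟨z⟩^m ⟨u−z⟩^{−n} for all u, z ∈ ℝ^{2d}, where Op_{BJ}(σ) is defined by ⟨Op_{BJ}(σ)f, h⟩ = ⟨σ, ∫₀¹ W_τ(h,f) dτ⟩. -/

import Mathlib

open scoped Real BigOperators
open Complex MeasureTheory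

noncomputable section

variable {d : ℕ}

/-- The Japanese bracket on phase space `ℝ^{2d} = ℝ^d × ℝ^d` (Euclidean norm). -/
def jb2 (w : (Fin d → ℝ) × (Fin d → ℝ)) : ℝ :=
  Real.sqrt (1 + ∑ i, (w.1 i) ^ 2 + ∑ i, (w.2 i) ^ 2)

/-- Directional derivative operator. -/
def pdir {E : Type*} [NormedAddCommGroup E] [NormedSpace ℝ E] (v : E) (h : E → ℂ) : E → ℂ :=
  fun y => fderiv ℝ h y v

/-- Iterated directional derivatives along a list of directions. -/
def mpdList {E : Type*} [NormedAddCommGroup E] [NormedSpace ℝ E]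
    (vs : List E) (h : E → ℂ) : E → ℂ :=
  vs.foldr pdir h

/-- The list of coordinate directions encoding the multi-index `α`. -/
def stdList (d : ℕ) (α : Fin d → ℕ) : List (Fin d → ℝ) :=
  (List.finRange d).flatMap fun i => List.replicate (α i) (Pi.single i 1)

/-- Directions on phase space encoding a multi-index on `ℝ^{2d}`. -/
def stdList2 (d : ℕ) (α : (Fin d → ℕ) × (Fin d → ℕ)) :
    List ((Fin d → ℝ) × (Fin d → ℝ)) :=
  ((stdList d α.1).map fun v => (v, 0)) ++ ((stdList d α.2).map fun v => (0, v))

/-- The multi-index partial derivative `∂^α` on phase space. -/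
def mpd2 (α : (Fin d → ℕ) × (Fin d → ℕ)) (h : (Fin d → ℝ) × (Fin d → ℝ) → ℂ) :
    (Fin d → ℝ) × (Fin d → ℝ) → ℂ :=
  mpdList (stdList2 d α) h

/-- The Hörmander-type symbol class `S^m(ℝ^{2d})`. -/
def SmSymbol (d : ℕ) (m : ℝ) (σ : (Fin d → ℝ) × (Fin d → ℝ) → ℂ) : Prop :=
  ContDiff ℝ (⊤ : ℕ∞) σ ∧
    ∀ α : (Fin d → ℕ) × (Fin d → ℕ), ∃ C : ℝ, ∀ z, ‖mpd2 α σ z‖ ≤ C * jb2 z ^ m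

/-- The seminorm `|σ|_{n,m} = sup_{|α| ≤ n} sup_z |∂^α σ(z)| ⟨z⟩^{-m}`. -/
def smSeminorm (d : ℕ) (n : ℕ) (m : ℝ) (σ : (Fin d → ℝ) × (Fin d → ℝ) → ℂ) : ℝ :=
  sSup {r | ∃ α : (Fin d → ℕ) × (Fin d → ℕ), ∃ z,
    (∑ i, α.1 i) + (∑ i, α.2 i) ≤ n ∧ r = ‖mpd2 α σ z‖ * jb2 z ^ (-m)}

/-- The time-frequency shift `π(x,ω)f(t) = e^{2πiωt} f(t-x)`. -/
def tshift (w : (Fin d → ℝ) × (Fin d → ℝ)) (g : (Fin d → ℝ) → ℂ) :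
    (Fin d → ℝ) → ℂ :=
  fun t => Complex.exp (2 * π * Complex.I * (∑ i, w.2 i * t i)) * g (t - w.1)

/-- The cross-τ-Wigner distribution. -/
def wig (τ : ℝ) (f h : (Fin d → ℝ) → ℂ) : (Fin d → ℝ) × (Fin d → ℝ) → ℂ :=
  fun p => ∫ y : Fin d → ℝ,
    Complex.exp (-(2 * π * Complex.I * (∑ i, y i * p.2 i))) * f (p.1 + τ • y) *
      (starRingEnd ℂ) (h (p.1 - (1 - τ) • y))


/-- The Born–Jordan Gabor matrix entry
`⟨Op_{BJ}(σ)π(z)g, π(u)g⟩ = ⟨σ, ∫₀¹ W_τ(π(u)g, π(z)g) dτ⟩`. -/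
def bjMatrix (σ : (Fin d → ℝ) × (Fin d → ℝ) → ℂ) (g : (Fin d → ℝ) → ℂ)
    (z u : (Fin d → ℝ) × (Fin d → ℝ)) : ℂ :=
  ∫ p : (Fin d → ℝ) × (Fin d → ℝ),
    σ p * (starRingEnd ℂ) (∫ τ in (0 : ℝ)..1, wig τ (tshift u g) (tshift z g) p)

open scoped LineDeriv SchwartzMap

/-- The integral of a line derivative vanishes. -/
lemma integral_hasLineDerivAt_eq_zero {E : Type*} [NormedAddCommGroup E] [NormedSpace ℝ E]
    [FiniteDimensional ℝ E] [MeasurableSpace E] [BorelSpace E] {μ : Measure E}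
    [μ.IsAddHaarMeasure] {h h' : E → ℂ} {v : E} (hh : Integrable h μ) (hh' : Integrable h' μ)
    (hd : ∀ x, HasLineDerivAt ℝ h (h' x) x v) : ∫ x, h' x ∂μ = 0 := by
  have := integral_bilinear_hasLineDerivAt_right_eq_neg_left_of_integrable (μ := μ)
    (f := fun _ => (1 : ℂ)) (f' := fun _ => 0) (g := h) (g' := h') (v := v)
    (B := ContinuousLinearMap.mul ℝ ℂ) (by simp) (by simpa using hh') (by simpa using hh)
    (fun x _ => by simpa [HasLineDerivAt] using hasDerivAt_const (0 : ℝ) (1 : ℂ))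
    (fun x _ => hd x)
  simpa using this

lemma SchwartzMap.hasLineDerivAt {E : Type*} [NormedAddCommGroup E] [NormedSpace ℝ E]
    (g : 𝓢(E, ℂ)) (x v : E) : HasLineDerivAt ℝ g ((∂_{v} g) x) x v := by
  rw [SchwartzMap.lineDerivOp_apply_eq_fderiv]
  exact (g.differentiableAt.hasFDerivAt).hasLineDerivAt v

/-- Multiplication of a Schwartz function by the `i`-th coordinate. -/
def coordMul (i : Fin d) (g : 𝓢(Fin d → ℝ, ℂ)) : 𝓢(Fin d → ℝ, ℂ) :=
  SchwartzMap.smulLeftCLM ℂ (fun x : Fin d → ℝ => x i) g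

lemma coordMul_apply (i : Fin d) (g : 𝓢(Fin d → ℝ, ℂ)) (x : Fin d → ℝ) :
    coordMul i g x = x i * g x := by
  have h : (fun x : Fin d → ℝ => x i).HasTemperateGrowth :=
    (ContinuousLinearMap.proj (R := ℝ) (φ := fun _ : Fin d => ℝ) i).hasTemperateGrowth
  rw [coordMul, SchwartzMap.smulLeftCLM_apply_apply h]
  simp

/-- The integrand of the (conjugated) cross-`τ`-Wigner distribution of two Schwartz functions. -/
def ambKer (g₁ g₂ : 𝓢(Fin d → ℝ, ℂ)) (τ : ℝ) (p : (Fin d → ℝ) × (Fin d → ℝ))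
    (y : Fin d → ℝ) : ℂ :=
  cexp (2 * π * I * (∑ i, y i * p.2 i : ℝ)) * g₁ (p.1 + τ • y) * g₂ (p.1 - (1 - τ) • y)

lemma norm_cexp_two_pi_I (r : ℝ) : ‖cexp (2 * π * I * (r : ℂ))‖ = 1 := by
  rw [show 2 * π * I * (r : ℂ) = ((2 * π * r : ℝ) : ℂ) * I by push_cast; ring]
  exact norm_exp_ofReal_mul_I _

lemma SchwartzMap.exists_one_add_norm_pow_mul_le {E : Type*} [NormedAddCommGroup E]
    [NormedSpace ℝ E] (g : 𝓢(E, ℂ)) (k : ℕ) :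
    ∃ C, 0 ≤ C ∧ ∀ x, (1 + ‖x‖) ^ k * ‖g x‖ ≤ C := by
  refine ⟨2 ^ k * ((Finset.Iic (k, 0)).sup fun m => SchwartzMap.seminorm ℝ m.1 m.2) g,
    by positivity, fun x => ?_⟩
  simpa using SchwartzMap.one_add_le_sup_seminorm_apply (𝕜 := ℝ) (m := (k, 0))
    (le_refl k) (le_refl 0) g x

lemma ambKer_dominated (g₁ g₂ : 𝓢(Fin d → ℝ, ℂ)) :
    ∃ b : (Fin d → ℝ) → ℝ, Integrable b ∧ ∀ τ p y, ‖ambKer g₁ g₂ τ p y‖ ≤ b y := by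
  obtain ⟨C₁, hC₁, h₁⟩ := g₁.exists_one_add_norm_pow_mul_le (d + 1)
  obtain ⟨C₂, hC₂, h₂⟩ := g₂.exists_one_add_norm_pow_mul_le (d + 1)
  refine ⟨fun y => C₁ * C₂ * (1 + ‖y‖) ^ (-(d + 1 : ℝ)),
    (integrable_one_add_norm (by simp)).const_mul _, fun τ p y => ?_⟩
  set a := p.1 + τ • y
  set b := p.1 - (1 - τ) • y
  have hy : y = a - b := by simp only [a, b]; module
  have hle : 1 + ‖y‖ ≤ (1 + ‖a‖) * (1 + ‖b‖) := by
    have := norm_sub_le a b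
    rw [← hy] at this
    nlinarith [norm_nonneg a, norm_nonneg b, mul_nonneg (norm_nonneg a) (norm_nonneg b)]
  have hpos : 0 < 1 + ‖y‖ := by positivity
  beta_reduce
  rw [Real.rpow_neg hpos.le, ← div_eq_mul_inv, le_div_iff₀ (by positivity),
    show (d + 1 : ℝ) = ((d + 1 : ℕ) : ℝ) by push_cast; rfl, Real.rpow_natCast, ambKer,
    norm_mul, norm_mul, norm_cexp_two_pi_I, one_mul]
  calc ‖g₁ a‖ * ‖g₂ b‖ * (1 + ‖y‖) ^ (d + 1)
      ≤ ‖g₁ a‖ * ‖g₂ b‖ * ((1 + ‖a‖) * (1 + ‖b‖)) ^ (d + 1) := by gcongr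
    _ = ((1 + ‖a‖) ^ (d + 1) * ‖g₁ a‖) * ((1 + ‖b‖) ^ (d + 1) * ‖g₂ b‖) := by
        rw [mul_pow]; ring
    _ ≤ C₁ * C₂ := mul_le_mul (h₁ a) (h₂ b) (by positivity) hC₁

lemma continuous_ambKer {X : Type*} [TopologicalSpace X] (g₁ g₂ : 𝓢(Fin d → ℝ, ℂ)) {τ : X → ℝ}
    {p : X → (Fin d → ℝ) × (Fin d → ℝ)} {y : X → Fin d → ℝ} (hτ : Continuous τ)
    (hp : Continuous p) (hy : Continuous y) :
    Continuous fun x => ambKer g₁ g₂ (τ x) (p x) (y x) := by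
  unfold ambKer
  refine (Continuous.mul ?_ (g₁.continuous.comp ?_)).mul (g₂.continuous.comp ?_)
  · exact continuous_exp.comp (continuous_const.mul (continuous_ofReal.comp (by fun_prop)))
  · fun_prop
  · fun_prop

lemma integrable_ambKer (g₁ g₂ : 𝓢(Fin d → ℝ, ℂ)) (τ : ℝ) (p : (Fin d → ℝ) × (Fin d → ℝ)) :
    Integrable (ambKer g₁ g₂ τ p) := by
  obtain ⟨b, hb, h⟩ := ambKer_dominated g₁ g₂
  have hc : Continuous (ambKer g₁ g₂ τ p) :=
    continuous_ambKer g₁ g₂ continuous_const continuous_const continuous_id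
  exact hb.mono' hc.aestronglyMeasurable (.of_forall fun y => h τ p y)

/-- The (conjugated) cross-`τ`-Wigner distribution of two Schwartz functions. -/
def amb (g₁ g₂ : 𝓢(Fin d → ℝ, ℂ)) (τ : ℝ) (p : (Fin d → ℝ) × (Fin d → ℝ)) : ℂ :=
  ∫ y, ambKer g₁ g₂ τ p y

lemma continuous_amb (g₁ g₂ : 𝓢(Fin d → ℝ, ℂ)) :
    Continuous fun q : ℝ × ((Fin d → ℝ) × (Fin d → ℝ)) => amb g₁ g₂ q.1 q.2 := by
  obtain ⟨b, hb, h⟩ := ambKer_dominated g₁ g₂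
  refine continuous_of_dominated
    (F := fun (q : ℝ × ((Fin d → ℝ) × (Fin d → ℝ))) y => ambKer g₁ g₂ q.1 q.2 y) (bound := b)
    (fun q => (integrable_ambKer g₁ g₂ q.1 q.2).aestronglyMeasurable)
    (fun q => .of_forall fun y => h q.1 q.2 y) hb (.of_forall fun y => ?_)
  exact continuous_ambKer g₁ g₂ continuous_fst continuous_snd continuous_const

/-- Uniform domination of a pointwise derivative allows differentiation of `amb`. -/
lemma hasLineDerivAt_amb {g₁ g₂ : 𝓢(Fin d → ℝ, ℂ)} {τ : ℝ} {v : (Fin d → ℝ) × (Fin d → ℝ)}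
    {K : (Fin d → ℝ) × (Fin d → ℝ) → (Fin d → ℝ) → ℂ} {b : (Fin d → ℝ) → ℝ}
    (hK : ∀ p, AEStronglyMeasurable (K p) volume) (hb : Integrable b)
    (hKb : ∀ p y, ‖K p y‖ ≤ b y)
    (hd : ∀ p y, HasLineDerivAt ℝ (fun p => ambKer g₁ g₂ τ p y) (K p y) p v)
    (p : (Fin d → ℝ) × (Fin d → ℝ)) :
    HasLineDerivAt ℝ (amb g₁ g₂ τ) (∫ y, K p y) p v := by
  have := (hasDerivAt_integral_of_dominated_loc_of_deriv_le (μ := volume) (x₀ := (0 : ℝ))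
    (s := Set.univ) (F := fun t y => ambKer g₁ g₂ τ (p + t • v) y)
    (F' := fun t y => K (p + t • v) y) (bound := b) Filter.univ_mem
    (.of_forall fun t => (integrable_ambKer g₁ g₂ τ _).aestronglyMeasurable)
    (integrable_ambKer g₁ g₂ τ _) (hK _) (.of_forall fun y t _ => hKb _ y) hb
    (.of_forall fun y t _ => ?_)).2
  · simpa [HasLineDerivAt, amb] using this
  · have h := hd (p + t • v) y
    have h2 : HasDerivAt (fun s : ℝ => s - t) 1 t := (hasDerivAt_id t).sub_const t
    have h3 : HasDerivAt (fun s : ℝ => ambKer g₁ g₂ τ (p + t • v + s • v) y) (K (p + t • v) y)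
      (t - t) := by simpa [HasLineDerivAt] using h
    have h4 := HasDerivAt.scomp (h := fun s : ℝ => s - t) t h3 h2
    simp only [one_smul] at h4
    convert! h4 using 1
    funext s
    simp only [Function.comp]
    congr 1
    module

lemma hasLineDerivAt_amb_fst (g₁ g₂ : 𝓢(Fin d → ℝ, ℂ)) (τ : ℝ) (v : Fin d → ℝ)
    (p : (Fin d → ℝ) × (Fin d → ℝ)) :
    HasLineDerivAt ℝ (amb g₁ g₂ τ) (amb (∂_{v} g₁) g₂ τ p + amb g₁ (∂_{v} g₂) τ p) p (v, 0) := by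
  obtain ⟨b₁, hb₁, h₁⟩ := ambKer_dominated (∂_{v} g₁) g₂
  obtain ⟨b₂, hb₂, h₂⟩ := ambKer_dominated g₁ (∂_{v} g₂)
  rw [amb, amb, ← integral_add (integrable_ambKer _ _ _ _) (integrable_ambKer _ _ _ _)]
  refine hasLineDerivAt_amb
    (K := fun p y => ambKer (∂_{v} g₁) g₂ τ p y + ambKer g₁ (∂_{v} g₂) τ p y)
    (fun p => ((integrable_ambKer _ _ _ _).add (integrable_ambKer _ _ _ _)).aestronglyMeasurable)
    (hb₁.add hb₂) (fun p y => (norm_add_le _ _).trans (add_le_add (h₁ _ _ _) (h₂ _ _ _)))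
    (fun p y => ?_) p
  have e₁ := g₁.hasLineDerivAt (p.1 + τ • y) v
  have e₂ := g₂.hasLineDerivAt (p.1 - (1 - τ) • y) v
  have := ((hasDerivAt_const (0 : ℝ) (cexp (2 * π * I * (∑ i, y i * p.2 i : ℝ)))).mul e₁).mul e₂
  unfold HasLineDerivAt
  convert! this using 1
  · funext t
    simp [ambKer, add_right_comm, add_sub_right_comm]
  · simp [ambKer]

lemma hasLineDerivAt_amb_snd (g₁ g₂ : 𝓢(Fin d → ℝ, ℂ)) (τ : ℝ) (i : Fin d)
    (p : (Fin d → ℝ) × (Fin d → ℝ)) :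
    HasLineDerivAt ℝ (amb g₁ g₂ τ)
      (2 * π * I * amb (coordMul i g₁) g₂ τ p + -(2 * π * I) * amb g₁ (coordMul i g₂) τ p) p
      (0, Pi.single i 1) := by
  obtain ⟨b₁, hb₁, h₁⟩ := ambKer_dominated (coordMul i g₁) g₂
  obtain ⟨b₂, hb₂, h₂⟩ := ambKer_dominated g₁ (coordMul i g₂)
  rw [amb, amb, ← integral_const_mul, ← integral_const_mul,
    ← integral_add ((integrable_ambKer _ _ _ _).const_mul _)
    ((integrable_ambKer _ _ _ _).const_mul _)]
  refine hasLineDerivAt_amb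
    (K := fun p y => 2 * π * I * ambKer (coordMul i g₁) g₂ τ p y +
      -(2 * π * I) * ambKer g₁ (coordMul i g₂) τ p y)
    (fun p => (((integrable_ambKer _ _ _ _).const_mul _).add
      ((integrable_ambKer _ _ _ _).const_mul _)).aestronglyMeasurable)
    ((hb₁.const_mul ‖2 * π * I‖).add (hb₂.const_mul ‖-(2 * π * I)‖)) (fun p y => ?_)
    (fun p y => ?_) p
  · refine (norm_add_le _ _).trans (add_le_add ?_ ?_) <;> rw [norm_mul]
    · exact mul_le_mul_of_nonneg_left (h₁ _ _ _) (norm_nonneg _)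
    · exact mul_le_mul_of_nonneg_left (h₂ _ _ _) (norm_nonneg _)
  · have hlin : HasDerivAt (fun t : ℝ => ((∑ j, y j * p.2 j + t * y i : ℝ) : ℂ)) (y i) 0 := by
      have : HasDerivAt (fun t : ℝ => ∑ j, y j * p.2 j + t * y i) (1 * y i) 0 :=
        ((hasDerivAt_id (0 : ℝ)).mul_const _).const_add _
      simpa using this.ofReal_comp
    have := ((hlin.const_mul (2 * π * I)).cexp.mul_const (g₁ (p.1 + τ • y))).mul_const
      (g₂ (p.1 - (1 - τ) • y))
    unfold HasLineDerivAt
    convert! this using 1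
    · funext t
      have : ∑ j, y j * (p + t • ((0, Pi.single i 1) : (Fin d → ℝ) × (Fin d → ℝ))).2 j
          = ∑ j, y j * p.2 j + t * y i := by
        simp [mul_add, Finset.sum_add_distrib, Pi.single_apply, mul_comm]
      beta_reduce
      rw [ambKer, this]
      simp
    · simp only [ambKer, coordMul_apply, Pi.add_apply, Pi.sub_apply, Pi.smul_apply, smul_eq_mul,
        zero_mul, add_zero]
      push_cast
      ring

lemma fst_mul_amb (g₁ g₂ : 𝓢(Fin d → ℝ, ℂ)) (τ : ℝ) (i : Fin d)
    (p : (Fin d → ℝ) × (Fin d → ℝ)) :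
    (p.1 i : ℂ) * amb g₁ g₂ τ p =
      (1 - τ) * amb (coordMul i g₁) g₂ τ p + τ * amb g₁ (coordMul i g₂) τ p := by
  simp only [amb]
  rw [← integral_const_mul, ← integral_const_mul, ← integral_const_mul,
    ← integral_add ((integrable_ambKer _ _ _ _).const_mul _)
    ((integrable_ambKer _ _ _ _).const_mul _)]
  congr 1
  funext y
  simp only [ambKer, coordMul_apply, Pi.add_apply, Pi.sub_apply, Pi.smul_apply, smul_eq_mul]
  push_cast
  ring

lemma snd_mul_amb (g₁ g₂ : 𝓢(Fin d → ℝ, ℂ)) (τ : ℝ) (i : Fin d)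
    (p : (Fin d → ℝ) × (Fin d → ℝ)) :
    (p.2 i : ℂ) * amb g₁ g₂ τ p =
      (-τ / (2 * π * I)) * amb (∂_{(Pi.single i 1 : Fin d → ℝ)} g₁) g₂ τ p +
      ((1 - τ) / (2 * π * I)) * amb g₁ (∂_{(Pi.single i 1 : Fin d → ℝ)} g₂) τ p := by
  set v : Fin d → ℝ := Pi.single i 1
  have hI₀ := (integrable_ambKer g₁ g₂ τ p).const_mul (2 * π * I * p.2 i)
  have hI₁ := (integrable_ambKer (∂_{v} g₁) g₂ τ p).const_mul τ
  have hI₂ := (integrable_ambKer g₁ (∂_{v} g₂) τ p).const_mul (-(1 - τ))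
  have hI : Integrable fun y =>
    τ * ambKer (∂_{v} g₁) g₂ τ p y + -(1 - τ) * ambKer g₁ (∂_{v} g₂) τ p y := hI₁.add hI₂
  have hz := integral_hasLineDerivAt_eq_zero (μ := volume) (v := v)
    (h := ambKer g₁ g₂ τ p)
    (h' := fun y => 2 * π * I * p.2 i * ambKer g₁ g₂ τ p y +
      (τ * ambKer (∂_{v} g₁) g₂ τ p y + -(1 - τ) * ambKer g₁ (∂_{v} g₂) τ p y))
    (integrable_ambKer _ _ _ _) (hI₀.add hI) (fun y => ?_)
  · rw [integral_add hI₀ hI, integral_add hI₁ hI₂, integral_const_mul, integral_const_mul,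
      integral_const_mul] at hz
    change 2 * π * I * p.2 i * amb g₁ g₂ τ p + (τ * amb (∂_{v} g₁) g₂ τ p +
      -(1 - τ) * amb g₁ (∂_{v} g₂) τ p) = 0 at hz
    have hpi : (2 * π * I : ℂ) ≠ 0 := two_pi_I_ne_zero
    have hpi' : (π : ℂ) ≠ 0 := by exact_mod_cast Real.pi_ne_zero
    field_simp
    linear_combination hz
  · have hlin : HasDerivAt (fun t : ℝ => ((∑ j, y j * p.2 j + t * p.2 i : ℝ) : ℂ)) (p.2 i) 0 := by
      have : HasDerivAt (fun t : ℝ => ∑ j, y j * p.2 j + t * p.2 i) (1 * p.2 i) 0 :=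
        ((hasDerivAt_id (0 : ℝ)).mul_const _).const_add _
      simpa using this.ofReal_comp
    have e₁ := (g₁.hasLineDerivAt (p.1 + τ • y) v).smul τ
    have e₂ := (g₂.hasLineDerivAt (p.1 - (1 - τ) • y) v).smul (-(1 - τ))
    have := ((hlin.const_mul (2 * π * I)).cexp.mul e₁).mul e₂
    unfold HasLineDerivAt
    convert! this using 1
    · funext t
      have : ∑ j, (y + t • v) j * p.2 j = ∑ j, y j * p.2 j + t * p.2 i := by
        simp [v, add_mul, Finset.sum_add_distrib, Pi.single_apply]
      have h₁ : p.1 + τ • (y + t • v) = p.1 + τ • y + t • τ • v := by module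
      have h₂ : p.1 - (1 - τ) • (y + t • v) = p.1 - (1 - τ) • y + t • (-(1 - τ)) • v := by module
      rw [ambKer, this, h₁, h₂]
      rfl
    · simp only [ambKer, Pi.mul_apply, zero_mul, add_zero, zero_smul, real_smul]
      push_cast
      ring

lemma jb2_sq (w : (Fin d → ℝ) × (Fin d → ℝ)) :
    jb2 w ^ 2 = 1 + ∑ i, (w.1 i) ^ 2 + ∑ i, (w.2 i) ^ 2 :=
  Real.sq_sqrt (by positivity)

lemma one_le_jb2 (w : (Fin d → ℝ) × (Fin d → ℝ)) : 1 ≤ jb2 w := by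
  rw [jb2, Real.one_le_sqrt, add_assoc]
  exact le_add_of_nonneg_right (by positivity)

lemma jb2_pos (w : (Fin d → ℝ) × (Fin d → ℝ)) : 0 < jb2 w :=
  one_pos.trans_le (one_le_jb2 w)

lemma jb2_neg (w : (Fin d → ℝ) × (Fin d → ℝ)) : jb2 (-w) = jb2 w := by
  simp [jb2]

lemma norm_le_jb2 (w : (Fin d → ℝ) × (Fin d → ℝ)) : ‖w‖ ≤ jb2 w := by
  have h₁ : 0 ≤ ∑ i, (w.1 i) ^ 2 := by positivity
  have h₂ : 0 ≤ ∑ i, (w.2 i) ^ 2 := by positivity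
  rw [Prod.norm_def]
  refine max_le ((pi_norm_le_iff_of_nonneg (jb2_pos w).le).2 fun i => ?_)
    ((pi_norm_le_iff_of_nonneg (jb2_pos w).le).2 fun i => ?_)
  · have := Finset.single_le_sum (fun j _ => sq_nonneg (w.1 j)) (Finset.mem_univ i)
    exact Real.abs_le_sqrt (by linarith)
  · have := Finset.single_le_sum (fun j _ => sq_nonneg (w.2 j)) (Finset.mem_univ i)
    exact Real.abs_le_sqrt (by linarith)

lemma jb2_add_le (a b : (Fin d → ℝ) × (Fin d → ℝ)) : jb2 (a + b) ≤ 2 * jb2 a * jb2 b := by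
  refine le_of_sq_le_sq ?_ (by have := jb2_pos a; have := jb2_pos b; positivity)
  have key (x y : Fin d → ℝ) : ∑ i, (x i + y i) ^ 2 ≤ 2 * ∑ i, x i ^ 2 + 2 * ∑ i, y i ^ 2 := by
    rw [Finset.mul_sum, Finset.mul_sum, ← Finset.sum_add_distrib]
    exact Finset.sum_le_sum fun i _ => by nlinarith [sq_nonneg (x i - y i)]
  have k₁ := key a.1 b.1
  have k₂ := key a.2 b.2
  rw [mul_pow, mul_pow, jb2_sq, jb2_sq, jb2_sq]
  have e₁ : 0 ≤ ∑ i, (a.1 i) ^ 2 := by positivity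
  have e₂ : 0 ≤ ∑ i, (a.2 i) ^ 2 := by positivity
  have e₃ : 0 ≤ ∑ i, (b.1 i) ^ 2 := by positivity
  have e₄ : 0 ≤ ∑ i, (b.2 i) ^ 2 := by positivity
  simp only [Prod.fst_add, Prod.snd_add, Pi.add_apply]
  nlinarith [mul_nonneg (add_nonneg e₁ e₂) (add_nonneg e₃ e₄)]

/-- Peetre's inequality. -/
lemma jb2_add_rpow_le (m : ℝ) (a b : (Fin d → ℝ) × (Fin d → ℝ)) :
    jb2 (a + b) ^ m ≤ 2 ^ |m| * jb2 a ^ m * jb2 b ^ |m| := by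
  have ha := jb2_pos a
  have hb := jb2_pos b
  have hab := jb2_pos (a + b)
  rcases le_total 0 m with hm | hm
  · rw [abs_of_nonneg hm, ← Real.mul_rpow (by positivity) (by positivity),
      ← Real.mul_rpow (by positivity) (by positivity)]
    exact Real.rpow_le_rpow hab.le (jb2_add_le a b) hm
  · have h := jb2_add_le (a + b) (-b)
    rw [add_neg_cancel_right, jb2_neg] at h
    rw [abs_of_nonpos hm]
    have h' := Real.rpow_le_rpow ha.le h (neg_nonneg.2 hm)
    rw [Real.mul_rpow (by positivity) (by positivity),
      Real.mul_rpow (by positivity) (by positivity), Real.rpow_neg ha.le,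
      Real.rpow_neg hab.le] at h'
    have pa := Real.rpow_pos_of_pos ha m
    have pab := Real.rpow_pos_of_pos hab m
    rw [inv_le_iff_one_le_mul₀ pa] at h'
    calc jb2 (a + b) ^ m = jb2 (a + b) ^ m * 1 := (mul_one _).symm
      _ ≤ jb2 (a + b) ^ m * (jb2 a ^ m * (2 ^ (-m) * (jb2 (a + b) ^ m)⁻¹ * jb2 b ^ (-m))) := by
          gcongr
          linarith
      _ = _ := by field_simp

/-- The families `F τ` on phase space obtained from the functions `amb g₁ g₂` by sums and by
multiplication with continuous functions of `τ`. -/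
inductive IsAmb : (ℝ → (Fin d → ℝ) × (Fin d → ℝ) → ℂ) → Prop
  | base (g₁ g₂ : 𝓢(Fin d → ℝ, ℂ)) : IsAmb (amb g₁ g₂)
  | add {F G : ℝ → (Fin d → ℝ) × (Fin d → ℝ) → ℂ} (hF : IsAmb F) (hG : IsAmb G) :
      IsAmb fun τ p => F τ p + G τ p
  | mul {F : ℝ → (Fin d → ℝ) × (Fin d → ℝ) → ℂ} {c : ℝ → ℂ} (hc : Continuous c) (hF : IsAmb F) :
      IsAmb fun τ p => c τ * F τ p

namespace IsAmb

variable {F : ℝ → (Fin d → ℝ) × (Fin d → ℝ) → ℂ}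

lemma continuous (hF : IsAmb F) :
    Continuous fun q : ℝ × ((Fin d → ℝ) × (Fin d → ℝ)) => F q.1 q.2 := by
  induction hF with
  | base g₁ g₂ => exact continuous_amb g₁ g₂
  | add _ _ h₁ h₂ => exact h₁.add h₂
  | mul hc _ h => exact (hc.comp continuous_fst).mul h

lemma continuous_apply (hF : IsAmb F) (τ : ℝ) : Continuous (F τ) :=
  Continuous.comp' (f := fun p => (τ, p)) hF.continuous (by fun_prop)

lemma bounded (hF : IsAmb F) :
    ∃ C, 0 ≤ C ∧ ∀ τ ∈ Set.Icc (0 : ℝ) 1, ∀ p, ‖F τ p‖ ≤ C := by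
  induction hF with
  | base g₁ g₂ =>
    obtain ⟨b, hb, h⟩ := ambKer_dominated g₁ g₂
    have hi (τ p) : ‖amb g₁ g₂ τ p‖ ≤ ∫ y, b y :=
      norm_integral_le_of_norm_le hb (.of_forall fun y => h τ p y)
    exact ⟨_, (norm_nonneg _).trans (hi 0 0), fun τ _ p => hi τ p⟩
  | add _ _ h₁ h₂ =>
    obtain ⟨C₁, hC₁, h₁⟩ := h₁
    obtain ⟨C₂, hC₂, h₂⟩ := h₂
    exact ⟨C₁ + C₂, by positivity, fun τ hτ p =>
      (norm_add_le _ _).trans (add_le_add (h₁ τ hτ p) (h₂ τ hτ p))⟩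
  | mul hc _ h =>
    obtain ⟨C, hC, h⟩ := h
    obtain ⟨D, hD⟩ := isCompact_Icc.exists_bound_of_continuousOn (s := Set.Icc (0 : ℝ) 1)
      hc.continuousOn
    have hD0 : 0 ≤ D := (norm_nonneg _).trans (hD 0 (by simp))
    refine ⟨D * C, by positivity, fun τ hτ p => ?_⟩
    rw [norm_mul]
    exact mul_le_mul (hD τ hτ) (h τ hτ p) (norm_nonneg _) hD0

end IsAmb

instance isAddHaarMeasure_volume_phaseSpace :
    (volume : Measure ((Fin d → ℝ) × (Fin d → ℝ))).IsAddHaarMeasure :=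
  Measure.prod.instIsAddHaarMeasure (volume : Measure (Fin d → ℝ)) (volume : Measure (Fin d → ℝ))

/-- The coordinate directions of phase space. -/
def coordDir : Fin d ⊕ Fin d → (Fin d → ℝ) × (Fin d → ℝ)
  | .inl i => (Pi.single i 1, 0)
  | .inr i => (0, Pi.single i 1)

/-- The coordinates on phase space. -/
def coordVal (w : (Fin d → ℝ) × (Fin d → ℝ)) : Fin d ⊕ Fin d → ℝ
  | .inl i => w.1 i
  | .inr i => w.2 i

lemma jb2_sq_eq_coordVal (w : (Fin d → ℝ) × (Fin d → ℝ)) :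
    jb2 w ^ 2 = 1 + ∑ j, coordVal w j ^ 2 := by
  rw [jb2_sq, Fintype.sum_sum_type, add_assoc]
  rfl

namespace IsAmb

variable {F : ℝ → (Fin d → ℝ) × (Fin d → ℝ) → ℂ}

lemma congr {G : ℝ → (Fin d → ℝ) × (Fin d → ℝ) → ℂ} (hF : IsAmb F)
    (h : ∀ τ p, G τ p = F τ p) : IsAmb G := by
  rwa [show G = F from funext fun τ => funext fun p => h τ p]

lemma exists_hasLineDerivAt (hF : IsAmb F) (j : Fin d ⊕ Fin d) :
    ∃ F', IsAmb F' ∧ ∀ τ p, HasLineDerivAt ℝ (F τ) (F' τ p) p (coordDir j) := by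
  induction hF with
  | base g₁ g₂ =>
    rcases j with i | i
    · exact ⟨_, (base _ g₂).add (base g₁ _), fun τ p => hasLineDerivAt_amb_fst g₁ g₂ τ _ p⟩
    · exact ⟨_, ((base _ g₂).mul continuous_const).add ((base g₁ _).mul continuous_const),
        fun τ p => hasLineDerivAt_amb_snd g₁ g₂ τ i p⟩
  | add _ _ h₁ h₂ =>
    obtain ⟨F₁, hF₁, h₁⟩ := h₁
    obtain ⟨F₂, hF₂, h₂⟩ := h₂
    exact ⟨_, hF₁.add hF₂, fun τ p => HasDerivAt.add (h₁ τ p) (h₂ τ p)⟩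
  | mul hc _ h =>
    obtain ⟨F₁, hF₁, h₁⟩ := h
    exact ⟨_, hF₁.mul hc, fun τ p => HasDerivAt.const_mul _ (h₁ τ p)⟩

lemma coordVal_mul (hF : IsAmb F) (j : Fin d ⊕ Fin d) :
    IsAmb fun τ p => (coordVal p j : ℂ) * F τ p := by
  induction hF with
  | base g₁ g₂ =>
    rcases j with i | i
    · exact (((base (coordMul i g₁) g₂).mul (c := fun τ => 1 - τ) (by fun_prop)).add
        ((base g₁ (coordMul i g₂)).mul (c := fun τ => τ) (by fun_prop))).congr
        fun τ p => fst_mul_amb g₁ g₂ τ i p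
    · exact (((base (∂_{(Pi.single i 1 : Fin d → ℝ)} g₁) g₂).mul
        (c := fun τ => -τ / (2 * π * I)) (by fun_prop)).add
        ((base g₁ (∂_{(Pi.single i 1 : Fin d → ℝ)} g₂)).mul
        (c := fun τ => (1 - τ) / (2 * π * I)) (by fun_prop))).congr
        fun τ p => snd_mul_amb g₁ g₂ τ i p
  | add _ _ h₁ h₂ => exact (h₁.add h₂).congr fun τ p => mul_add _ _ _
  | mul hc _ h => exact (h.mul hc).congr fun τ p => mul_left_comm _ _ _

lemma zero : IsAmb (fun _ _ => 0 : ℝ → (Fin d → ℝ) × (Fin d → ℝ) → ℂ) :=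
  ((base 0 0).mul (c := fun _ => 0) continuous_const).congr fun τ p => by simp

lemma sum {ι : Type*} (s : Finset ι) {F : ι → ℝ → (Fin d → ℝ) × (Fin d → ℝ) → ℂ}
    (hF : ∀ i, IsAmb (F i)) : IsAmb fun τ p => ∑ i ∈ s, F i τ p := by
  classical
  induction s using Finset.induction_on with
  | empty => exact zero.congr fun τ p => by simp
  | insert a s ha ih => exact ((hF a).add ih).congr fun τ p => Finset.sum_insert ha

lemma jb2_pow_mul (hF : IsAmb F) (k : ℕ) :
    IsAmb fun τ p => ((jb2 p ^ (2 * k) : ℝ) : ℂ) * F τ p := by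
  induction k with
  | zero => exact hF.congr fun τ p => by simp
  | succ k ih =>
    refine (ih.add (sum Finset.univ fun j => (ih.coordVal_mul j).coordVal_mul j)).congr
      fun τ p => ?_
    rw [mul_add, mul_one, pow_add, jb2_sq_eq_coordVal]
    push_cast
    rw [mul_add, mul_one, add_mul, Finset.mul_sum, Finset.sum_mul]
    congr 1
    exact Finset.sum_congr rfl fun j _ => by ring

/-- Members of the class decay rapidly, uniformly in `τ ∈ [0, 1]`. -/
lemma exists_integrable_bound (hF : IsAmb F) (M : ℕ) :
    ∃ b : (Fin d → ℝ) × (Fin d → ℝ) → ℝ, Integrable b ∧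
      ∀ τ ∈ Set.Icc (0 : ℝ) 1, ∀ p, jb2 p ^ M * ‖F τ p‖ ≤ b p := by
  obtain ⟨C, hC, h⟩ := (hF.jb2_pow_mul (M + (2 * d + 1))).bounded
  refine ⟨fun p => 2 ^ (2 * d + 1) * C * (1 + ‖p‖) ^ (-((2 * d + 1 : ℕ) : ℝ)),
    (integrable_one_add_norm (by simp; linarith)).const_mul _, fun τ hτ p => ?_⟩
  have h1 := one_le_jb2 p
  have hp : 1 + ‖p‖ ≤ 2 * jb2 p := by linarith [norm_le_jb2 p]
  have hpos : 0 < 1 + ‖p‖ := by positivity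
  have hj := h τ hτ p
  rw [norm_mul, norm_real, Real.norm_of_nonneg (by positivity)] at hj
  beta_reduce
  rw [Real.rpow_neg hpos.le, Real.rpow_natCast, ← div_eq_mul_inv, le_div_iff₀ (by positivity)]
  calc jb2 p ^ M * ‖F τ p‖ * (1 + ‖p‖) ^ (2 * d + 1)
      ≤ jb2 p ^ M * ‖F τ p‖ * (2 * jb2 p) ^ (2 * d + 1) := by gcongr
    _ = 2 ^ (2 * d + 1) * (jb2 p ^ (M + (2 * d + 1)) * ‖F τ p‖) := by ring
    _ ≤ 2 ^ (2 * d + 1) * (jb2 p ^ (2 * (M + (2 * d + 1))) * ‖F τ p‖) := by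
        gcongr
        omega
    _ ≤ 2 ^ (2 * d + 1) * C := by gcongr

lemma integrable_mul_mul {τ : ℝ} {b : (Fin d → ℝ) × (Fin d → ℝ) → ℝ} {M : ℕ}
    (hF : IsAmb F) (hb : Integrable b) (hbF : ∀ p, jb2 p ^ M * ‖F τ p‖ ≤ b p)
    {s e : (Fin d → ℝ) × (Fin d → ℝ) → ℂ} {B : ℝ} (hB : 0 ≤ B) (hs : Continuous s)
    (he : Continuous e) (hsB : ∀ p, ‖s p‖ ≤ B * jb2 p ^ M) (he1 : ∀ p, ‖e p‖ = 1) :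
    Integrable (fun p => s p * e p * F τ p) ∧ ∀ p, ‖s p * e p * F τ p‖ ≤ B * b p := by
  have key p : ‖s p * e p * F τ p‖ ≤ B * b p := by
    rw [norm_mul, norm_mul, he1, mul_one]
    calc ‖s p‖ * ‖F τ p‖ ≤ B * jb2 p ^ M * ‖F τ p‖ := by gcongr; exact hsB p
      _ = B * (jb2 p ^ M * ‖F τ p‖) := by ring
      _ ≤ B * b p := by gcongr; exact hbF p
  exact ⟨(hb.const_mul B).mono'
    ((hs.mul he).mul (hF.continuous_apply τ)).aestronglyMeasurable (.of_forall key), key⟩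

/-- Repeated integration by parts in one coordinate direction against a character. -/
lemma oscillatory_bound (hF : IsAmb F) (j : Fin d ⊕ Fin d) (M N : ℕ) :
    ∃ C, 0 ≤ C ∧ ∀ τ ∈ Set.Icc (0 : ℝ) 1, ∀ (s : ℕ → (Fin d → ℝ) × (Fin d → ℝ) → ℂ) (B : ℝ),
      0 ≤ B → (∀ k, Continuous (s k)) →
      (∀ k p, HasLineDerivAt ℝ (s k) (s (k + 1) p) p (coordDir j)) →
      (∀ k ≤ N, ∀ p, ‖s k p‖ ≤ B * jb2 p ^ M) →
      ∀ (e : (Fin d → ℝ) × (Fin d → ℝ) → ℂ) (κ : ℂ), Continuous e → (∀ p, ‖e p‖ = 1) →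
      (∀ p, HasLineDerivAt ℝ e (κ * e p) p (coordDir j)) →
      ‖κ‖ ^ N * ‖∫ p, s 0 p * e p * F τ p‖ ≤ C * B := by
  induction N generalizing F with
  | zero =>
    obtain ⟨b, hb, h⟩ := hF.exists_integrable_bound M
    refine ⟨|∫ p, b p|, abs_nonneg _, fun τ hτ s B hB hs _ hsB e κ he he1 _ => ?_⟩
    have := (hF.integrable_mul_mul hb (h τ hτ) hB (hs 0) he (hsB 0 le_rfl) he1).2
    have := norm_integral_le_of_norm_le (hb.const_mul B) (.of_forall this)
    rw [integral_const_mul] at this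
    rw [pow_zero, one_mul, mul_comm]
    exact this.trans (by gcongr; exact le_abs_self _)
  | succ N ih =>
    obtain ⟨b, hb, h⟩ := hF.exists_integrable_bound M
    obtain ⟨F', hF', hd⟩ := hF.exists_hasLineDerivAt j
    obtain ⟨b', hb', h'⟩ := hF'.exists_integrable_bound M
    obtain ⟨C₁, hC₁, ih₁⟩ := ih hF
    obtain ⟨C₂, hC₂, ih₂⟩ := ih hF'
    refine ⟨C₁ + C₂, by positivity, fun τ hτ s B hB hs hsd hsB e κ he he1 hed => ?_⟩
    have i₀ := (hF.integrable_mul_mul hb (h τ hτ) hB (hs 0) he (hsB 0 (by omega)) he1).1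
    have i₁ := (hF.integrable_mul_mul hb (h τ hτ) hB (hs 1) he (hsB 1 (by omega)) he1).1
    have i₂ := (hF'.integrable_mul_mul hb' (h' τ hτ) hB (hs 0) he (hsB 0 (by omega)) he1).1
    have i₁₂ : Integrable fun p => s 1 p * e p * F τ p + s 0 p * e p * F' τ p := i₁.add i₂
    have hz := integral_hasLineDerivAt_eq_zero i₀ ((i₀.const_mul κ).add i₁₂) (v := coordDir j)
      fun p => by
        have := ((hsd 0 p).mul (hed p)).mul (hd τ p)
        unfold HasLineDerivAt
        convert! this using 1
        simp only [Pi.add_apply, Pi.mul_apply, zero_smul, add_zero]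
        ring
    have hz' : κ * ∫ p, s 0 p * e p * F τ p =
        -((∫ p, s 1 p * e p * F τ p) + ∫ p, s 0 p * e p * F' τ p) := by
      rw [← integral_add i₁ i₂, ← integral_const_mul, eq_neg_iff_add_eq_zero,
        ← integral_add (i₀.const_mul κ) i₁₂]
      exact hz
    have e₁ := ih₁ τ hτ (fun k => s (k + 1)) B hB (fun k => hs _) (fun k p => hsd _ p)
      (fun k hk p => hsB _ (by omega) p) e κ he he1 hed
    have e₂ := ih₂ τ hτ s B hB hs hsd (fun k hk p => hsB _ (by omega) p) e κ he he1 hed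
    rw [pow_succ, mul_assoc, ← norm_mul, hz', norm_neg, add_mul]
    refine le_trans ?_ (add_le_add e₁ e₂)
    rw [← mul_add]
    gcongr
    exact norm_add_le _ _

end IsAmb

lemma contDiff_pdir {E : Type*} [NormedAddCommGroup E] [NormedSpace ℝ E] {h : E → ℂ}
    (hh : ContDiff ℝ (⊤ : ℕ∞) h) (v : E) : ContDiff ℝ (⊤ : ℕ∞) (pdir v h) :=
  (hh.fderiv_right (by simp)).clm_apply contDiff_const

lemma contDiff_iterate_pdir {E : Type*} [NormedAddCommGroup E] [NormedSpace ℝ E] {h : E → ℂ}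
    (hh : ContDiff ℝ (⊤ : ℕ∞) h) (v : E) (k : ℕ) : ContDiff ℝ (⊤ : ℕ∞) ((pdir v)^[k] h) := by
  induction k with
  | zero => exact hh
  | succ k ih => rw [Function.iterate_succ_apply']; exact contDiff_pdir ih v

lemma hasLineDerivAt_iterate_pdir {E : Type*} [NormedAddCommGroup E] [NormedSpace ℝ E] {h : E → ℂ}
    (hh : ContDiff ℝ (⊤ : ℕ∞) h) (v : E) (k : ℕ) (p : E) :
    HasLineDerivAt ℝ ((pdir v)^[k] h) ((pdir v)^[k + 1] h p) p v := by
  rw [Function.iterate_succ_apply']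
  exact (((contDiff_iterate_pdir hh v k).differentiable (by simp)) p).hasFDerivAt.hasLineDerivAt v

lemma List.flatMap_replicate_single {ι β : Type*} [DecidableEq ι] {l : List ι} (hl : l.Nodup)
    {i : ι} (hi : i ∈ l) (k : ℕ) (f : ι → β) :
    (l.flatMap fun j => List.replicate ((Pi.single i k : ι → ℕ) j) (f j)) =
      List.replicate k (f i) := by
  induction l with
  | nil => simp at hi
  | cons a l ih =>
    rw [List.nodup_cons] at hl
    rw [List.flatMap_cons]
    rcases eq_or_ne a i with rfl | h
    · have : (l.flatMap fun j => List.replicate ((Pi.single a k : ι → ℕ) j) (f j)) = [] :=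
        List.flatMap_eq_nil_iff.2 fun x hx => by
          rw [Pi.single_eq_of_ne (ne_of_mem_of_not_mem hx hl.1), List.replicate_zero]
      rw [this, Pi.single_eq_same, List.append_nil]
    · rw [Pi.single_eq_of_ne h, List.replicate_zero, List.nil_append,
        ih hl.2 ((List.mem_cons.1 hi).resolve_left h.symm)]

lemma stdList_single (i : Fin d) (k : ℕ) :
    stdList d (Pi.single i k) = List.replicate k (Pi.single i 1) :=
  List.flatMap_replicate_single (List.nodup_finRange d) (List.mem_finRange i) k _

lemma stdList_zero : stdList d 0 = [] := by
  simp [stdList]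

lemma mpdList_replicate {E : Type*} [NormedAddCommGroup E] [NormedSpace ℝ E] (v : E) (k : ℕ)
    (h : E → ℂ) : mpdList (List.replicate k v) h = (pdir v)^[k] h := by
  induction k with
  | zero => rfl
  | succ k ih =>
    rw [Function.iterate_succ_apply', ← ih]
    rfl

/-- The multi-index of order `k` in a single coordinate. -/
def coordIndex (k : ℕ) : Fin d ⊕ Fin d → (Fin d → ℕ) × (Fin d → ℕ)
  | .inl i => (Pi.single i k, 0)
  | .inr i => (0, Pi.single i k)

lemma sum_coordIndex (k : ℕ) (j : Fin d ⊕ Fin d) :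
    (∑ i, (coordIndex k j).1 i) + (∑ i, (coordIndex k j).2 i) = k := by
  rcases j with i | i <;> simp [coordIndex]

lemma mpd2_coordIndex (k : ℕ) (j : Fin d ⊕ Fin d) (h : (Fin d → ℝ) × (Fin d → ℝ) → ℂ) :
    mpd2 (coordIndex k j) h = (pdir (coordDir j))^[k] h := by
  rw [← mpdList_replicate, mpd2, stdList2]
  rcases j with i | i <;>
    simp [coordIndex, coordDir, stdList_single, stdList_zero]

lemma smSeminorm_nonneg (N : ℕ) (m : ℝ) (σ : (Fin d → ℝ) × (Fin d → ℝ) → ℂ) :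
    0 ≤ smSeminorm d N m σ := by
  refine Real.sSup_nonneg ?_
  rintro _ ⟨α, z, -, rfl⟩
  have := jb2_pos z
  positivity

lemma SmSymbol.norm_mpd2_le {m : ℝ} {σ : (Fin d → ℝ) × (Fin d → ℝ) → ℂ} (hσ : SmSymbol d m σ)
    {N : ℕ} {α : (Fin d → ℕ) × (Fin d → ℕ)} (hα : (∑ i, α.1 i) + (∑ i, α.2 i) ≤ N)
    (z : (Fin d → ℝ) × (Fin d → ℝ)) :
    ‖mpd2 α σ z‖ ≤ smSeminorm d N m σ * jb2 z ^ m := by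
  classical
  choose C hC using hσ.2
  obtain ⟨D, hD⟩ := ((Set.finite_Icc 0 ((fun _ => N, fun _ => N) :
    (Fin d → ℕ) × (Fin d → ℕ))).image C).bddAbove
  have hbdd : BddAbove {r | ∃ α : (Fin d → ℕ) × (Fin d → ℕ), ∃ z,
      (∑ i, α.1 i) + (∑ i, α.2 i) ≤ N ∧ r = ‖mpd2 α σ z‖ * jb2 z ^ (-m)} := by
    refine ⟨D, ?_⟩
    rintro _ ⟨α, z, hα, rfl⟩
    have hle : α ≤ (fun _ => N, fun _ => N) := by
      refine ⟨fun i => ?_, fun i => ?_⟩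
      · have := Finset.single_le_sum (f := α.1) (fun j _ => Nat.zero_le _) (Finset.mem_univ i)
        show α.1 i ≤ N
        omega
      · have := Finset.single_le_sum (f := α.2) (fun j _ => Nat.zero_le _) (Finset.mem_univ i)
        show α.2 i ≤ N
        omega
    have hz := Real.rpow_pos_of_pos (jb2_pos z) m
    rw [Real.rpow_neg (jb2_pos z).le, ← div_eq_mul_inv]
    exact ((div_le_iff₀ hz).2 (hC α z)).trans (hD ⟨α, ⟨zero_le, hle⟩, rfl⟩)
  have h := le_csSup hbdd ⟨α, z, hα, rfl⟩
  rwa [Real.rpow_neg (jb2_pos z).le, ← div_eq_mul_inv,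
    div_le_iff₀ (Real.rpow_pos_of_pos (jb2_pos z) m)] at h

/-- The point `T_τ(z, u)` around which the cross-`τ`-Wigner distribution of `π(u)g` and `π(z)g`
is concentrated. -/
def tfCenter (τ : ℝ) (z u : (Fin d → ℝ) × (Fin d → ℝ)) : (Fin d → ℝ) × (Fin d → ℝ) :=
  ((1 - τ) • u.1 + τ • z.1, τ • u.2 + (1 - τ) • z.2)

lemma jb2_tfCenter_sub_le {τ : ℝ} (hτ : τ ∈ Set.Icc (0 : ℝ) 1)
    (z u : (Fin d → ℝ) × (Fin d → ℝ)) : jb2 (tfCenter τ z u - z) ≤ jb2 (u - z) := by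
  have key {c : ℝ} (hc : c ∈ Set.Icc (0 : ℝ) 1) (x : ℝ) : (c * x) ^ 2 ≤ x ^ 2 := by
    rw [mul_pow]
    exact mul_le_of_le_one_left (sq_nonneg x) (pow_le_one₀ hc.1 hc.2)
  have hτ' : 1 - τ ∈ Set.Icc (0 : ℝ) 1 := ⟨by linarith [hτ.2], by linarith [hτ.1]⟩
  refine Real.sqrt_le_sqrt (add_le_add (add_le_add le_rfl ?_) ?_)
  · refine Finset.sum_le_sum fun i _ => le_of_eq_of_le ?_ (key hτ' ((u - z).1 i))
    simp only [tfCenter, Prod.fst_sub, Pi.sub_apply, Pi.add_apply, Pi.smul_apply, smul_eq_mul]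
    ring
  · refine Finset.sum_le_sum fun i _ => le_of_eq_of_le ?_ (key hτ ((u - z).2 i))
    simp only [tfCenter, Prod.snd_sub, Pi.sub_apply, Pi.add_apply, Pi.smul_apply, smul_eq_mul]
    ring

lemma jb2_add_tfCenter_rpow_le (m : ℝ) {τ : ℝ} (hτ : τ ∈ Set.Icc (0 : ℝ) 1)
    (z u q : (Fin d → ℝ) × (Fin d → ℝ)) :
    jb2 (q + tfCenter τ z u) ^ m ≤
      2 ^ |m| * 2 ^ |m| * jb2 z ^ m * jb2 (u - z) ^ ⌈|m|⌉₊ * jb2 q ^ ⌈|m|⌉₊ := by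
  have hz := jb2_pos z
  have up (w : (Fin d → ℝ) × (Fin d → ℝ)) : jb2 w ^ |m| ≤ jb2 w ^ ⌈|m|⌉₊ := by
    rw [← Real.rpow_natCast]
    exact Real.rpow_le_rpow_of_exponent_le (one_le_jb2 w) (Nat.le_ceil _)
  have hc : jb2 (tfCenter τ z u - z) ^ |m| ≤ jb2 (u - z) ^ ⌈|m|⌉₊ :=
    (Real.rpow_le_rpow (jb2_pos _).le (jb2_tfCenter_sub_le hτ z u) (abs_nonneg m)).trans (up _)
  have h₁ := jb2_add_rpow_le m (z + (tfCenter τ z u - z)) q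
  have h₂ := jb2_add_rpow_le m z (tfCenter τ z u - z)
  rw [show z + (tfCenter τ z u - z) + q = q + tfCenter τ z u by abel] at h₁
  have hq := jb2_pos q
  have hu := jb2_pos (u - z)
  calc jb2 (q + tfCenter τ z u) ^ m
      ≤ 2 ^ |m| * (2 ^ |m| * jb2 z ^ m * jb2 (tfCenter τ z u - z) ^ |m|) * jb2 q ^ |m| :=
        h₁.trans (by gcongr)
    _ ≤ 2 ^ |m| * (2 ^ |m| * jb2 z ^ m * jb2 (u - z) ^ ⌈|m|⌉₊) * jb2 q ^ ⌈|m|⌉₊ := by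
        gcongr
        exact up q
    _ = _ := by ring

/-- The complex conjugate of a Schwartz function. -/
def conjSchwartz (g : 𝓢(Fin d → ℝ, ℂ)) : 𝓢(Fin d → ℝ, ℂ) :=
  SchwartzMap.postcompCLM (𝕜 := ℝ) (conjCLE : ℂ →L[ℝ] ℂ) g

lemma conjSchwartz_apply (g : 𝓢(Fin d → ℝ, ℂ)) (x : Fin d → ℝ) :
    conjSchwartz g x = (starRingEnd ℂ) (g x) := rfl

/-- The phase of the cross-`τ`-Wigner distribution of `π(u)g` and `π(z)g` at `q + T_τ(z, u)`. -/
def tfPhase (τ : ℝ) (z u q : (Fin d → ℝ) × (Fin d → ℝ)) : ℝ :=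
  (∑ i, (u - z).1 i * q.2 i) - ∑ i, (u - z).2 i * (q + tfCenter τ z u).1 i

lemma conj_cexp_two_pi_I (r : ℝ) :
    (starRingEnd ℂ) (cexp (2 * π * I * r)) = cexp (2 * π * I * (-r : ℝ)) := by
  rw [← exp_conj]
  simp [map_ofNat]

lemma conj_wig_tshift (g : 𝓢(Fin d → ℝ, ℂ)) (τ : ℝ) (z u q : (Fin d → ℝ) × (Fin d → ℝ)) :
    (starRingEnd ℂ) (wig τ (tshift u g) (tshift z g) (q + tfCenter τ z u)) =
      cexp (2 * π * I * (tfPhase τ z u q : ℝ)) * amb (conjSchwartz g) g τ q := by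
  rw [wig, ← integral_conj, amb, ← integral_const_mul,
    ← integral_add_right_eq_self _ (u - z).1]
  congr 1 with y
  simp only [tshift, ambKer, conjSchwartz_apply, map_mul, conj_conj]
  have e₁ : (q + tfCenter τ z u).1 + τ • (y + (u - z).1) - u.1 = q.1 + τ • y := by
    ext i
    simp only [tfCenter, Prod.fst_add, Prod.fst_sub, Pi.add_apply, Pi.sub_apply, Pi.smul_apply,
      smul_eq_mul]
    ring
  have e₂ : (q + tfCenter τ z u).1 - (1 - τ) • (y + (u - z).1) - z.1 = q.1 - (1 - τ) • y := by
    ext i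
    simp only [tfCenter, Prod.fst_add, Prod.fst_sub, Pi.add_apply, Pi.sub_apply, Pi.smul_apply,
      smul_eq_mul]
    ring
  have e₃ : tfPhase τ z u q + ∑ i, y i * q.2 i =
      (∑ i, (y + (u - z).1) i * (q + tfCenter τ z u).2 i) -
      (∑ i, u.2 i * ((q + tfCenter τ z u).1 + τ • (y + (u - z).1)) i) +
      ∑ i, z.2 i * ((q + tfCenter τ z u).1 - (1 - τ) • (y + (u - z).1)) i := by
    rw [tfPhase]
    simp only [← Finset.sum_sub_distrib, ← Finset.sum_add_distrib]
    refine Finset.sum_congr rfl fun i _ => ?_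
    simp only [tfCenter, Prod.fst_add, Prod.fst_sub, Prod.snd_add, Prod.snd_sub, Pi.add_apply,
      Pi.sub_apply, Pi.smul_apply, smul_eq_mul]
    ring
  have c₁ := conj_cexp_two_pi_I (-∑ i, (y + (u - z).1) i * (q + tfCenter τ z u).2 i)
  have c₂ := conj_cexp_two_pi_I
    (∑ i, u.2 i * ((q + tfCenter τ z u).1 + τ • (y + (u - z).1)) i)
  rw [e₁, e₂]
  have hphase : cexp (2 * π * I * (tfPhase τ z u q : ℝ)) *
      cexp (2 * π * I * (∑ i, y i * q.2 i : ℝ)) =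
      cexp (2 * π * I * (∑ i, (y + (u - z).1) i * (q + tfCenter τ z u).2 i : ℝ)) *
      cexp (2 * π * I *
        (-∑ i, u.2 i * ((q + tfCenter τ z u).1 + τ • (y + (u - z).1)) i : ℝ)) *
      cexp (2 * π * I *
        (∑ i, z.2 i * ((q + tfCenter τ z u).1 - (1 - τ) • (y + (u - z).1)) i : ℝ)) := by
    simp only [← Complex.exp_add, ← mul_add, ← ofReal_add]
    rw [e₃]
    congr 3
  rw [neg_neg, ofReal_neg, mul_neg] at c₁
  rw [c₁, c₂]
  linear_combination (-((starRingEnd ℂ) (g (q.1 + τ • y)) * g (q.1 - (1 - τ) • y))) * hphase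

lemma continuous_tfCenter (z u : (Fin d → ℝ) × (Fin d → ℝ)) :
    Continuous fun τ => tfCenter τ z u := by
  unfold tfCenter
  fun_prop

lemma continuous_tfPhase (z u : (Fin d → ℝ) × (Fin d → ℝ)) :
    Continuous fun x : ℝ × ((Fin d → ℝ) × (Fin d → ℝ)) => tfPhase x.1 z u x.2 := by
  unfold tfPhase tfCenter
  fun_prop

lemma continuous_cexp_tfPhase (z u : (Fin d → ℝ) × (Fin d → ℝ)) :
    Continuous fun x : ℝ × ((Fin d → ℝ) × (Fin d → ℝ)) =>
      cexp (2 * π * I * (tfPhase x.1 z u x.2 : ℝ)) :=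
  continuous_exp.comp
    (continuous_const.mul (continuous_ofReal.comp (continuous_tfPhase z u)))

lemma hasLineDerivAt_cexp_tfPhase (τ : ℝ) (z u : (Fin d → ℝ) × (Fin d → ℝ))
    (j : Fin d ⊕ Fin d) :
    ∃ κ : ℂ, |coordVal (u - z) j.swap| ≤ ‖κ‖ ∧ ∀ q,
      HasLineDerivAt ℝ (fun q => cexp (2 * π * I * (tfPhase τ z u q : ℝ)))
        (κ * cexp (2 * π * I * (tfPhase τ z u q : ℝ))) q (coordDir j) := by
  obtain ⟨c, hc, hlin⟩ : ∃ c : ℝ, |c| = |coordVal (u - z) j.swap| ∧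
      ∀ q (t : ℝ), tfPhase τ z u (q + t • coordDir j) = tfPhase τ z u q + t * c := by
    rcases j with i | i
    · refine ⟨-(u - z).2 i, abs_neg _, fun q t => ?_⟩
      simp [tfPhase, coordDir, mul_add, Finset.sum_add_distrib, Pi.single_apply]
      ring
    · refine ⟨(u - z).1 i, rfl, fun q t => ?_⟩
      simp [tfPhase, coordDir, mul_add, Finset.sum_add_distrib, Pi.single_apply]
      ring
  refine ⟨2 * π * I * c, ?_, fun q => ?_⟩
  · rw [← hc]
    simp only [norm_mul, RCLike.norm_ofNat, norm_real, norm_I, mul_one, Real.norm_eq_abs,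
      abs_of_pos Real.pi_pos]
    exact le_mul_of_one_le_left (abs_nonneg c) (by linarith [Real.pi_gt_three])
  · unfold HasLineDerivAt
    simp only [hlin]
    have h : HasDerivAt (fun t : ℝ => 2 * π * I * ((tfPhase τ z u q + t * c : ℝ) : ℂ))
        (2 * π * I * c) 0 := by
      have := (((hasDerivAt_id (0 : ℝ)).mul_const c).const_add (tfPhase τ z u q)).ofReal_comp
      simpa using this.const_mul (2 * π * I)
    convert! h.cexp using 1
    simp [mul_comm]

/-- If every coordinate of `w` satisfies a weighted bound, so does the Japanese bracket of `w`. -/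
lemma jb2_pow_mul_le {w : (Fin d → ℝ) × (Fin d → ℝ)} {N : ℕ} {X D : ℝ} (hX : 0 ≤ X)
    (h₀ : X ≤ D) (h : ∀ j, |coordVal w j| ^ N * X ≤ D) :
    jb2 w ^ N * X ≤ (2 * d + 1) ^ N * D := by
  have hD : 0 ≤ D := hX.trans h₀
  obtain ⟨o, ho⟩ := Finite.exists_max
    fun o : Option (Fin d ⊕ Fin d) => o.elim 1 fun j => |coordVal w j|
  set A := o.elim 1 fun j => |coordVal w j| with hA
  have hA1 : 1 ≤ A := ho none
  have hAX : A ^ N * X ≤ D := by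
    rcases o with _ | j
    · simpa [hA] using h₀
    · exact h j
  have hjb : jb2 w ≤ (2 * d + 1) * A := by
    refine le_of_sq_le_sq ?_ (by positivity)
    rw [jb2_sq_eq_coordVal]
    have hs : ∑ j, coordVal w j ^ 2 ≤ ∑ _j : Fin d ⊕ Fin d, A ^ 2 :=
      Finset.sum_le_sum fun j _ => sq_le_sq' (neg_le_of_abs_le (ho (some j)))
        (le_of_abs_le (ho (some j)))
    simp only [Finset.sum_const, Finset.card_univ, Fintype.card_sum, Fintype.card_fin,
      nsmul_eq_mul] at hs
    push_cast at hs
    have hd : (0 : ℝ) ≤ d := d.cast_nonneg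
    nlinarith [mul_nonneg hd (sq_nonneg A), mul_nonneg (mul_nonneg hd hd) (sq_nonneg A)]
  have hjp := jb2_pos w
  calc jb2 w ^ N * X ≤ ((2 * d + 1) * A) ^ N * X := by gcongr
    _ = (2 * d + 1) ^ N * (A ^ N * X) := by rw [mul_pow, mul_assoc]
    _ ≤ _ := by gcongr

/-- The integrand of the Born–Jordan Gabor matrix, recentred at `T_τ(z, u)`. -/
def bjKernel (σ : (Fin d → ℝ) × (Fin d → ℝ) → ℂ) (g : 𝓢(Fin d → ℝ, ℂ))
    (z u : (Fin d → ℝ) × (Fin d → ℝ)) (τ : ℝ) (q : (Fin d → ℝ) × (Fin d → ℝ)) : ℂ :=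
  σ (q + tfCenter τ z u) * cexp (2 * π * I * (tfPhase τ z u q : ℝ)) * amb (conjSchwartz g) g τ q

lemma mul_conj_wig_tshift (σ : (Fin d → ℝ) × (Fin d → ℝ) → ℂ) (g : 𝓢(Fin d → ℝ, ℂ))
    (z u : (Fin d → ℝ) × (Fin d → ℝ)) (τ : ℝ) (p : (Fin d → ℝ) × (Fin d → ℝ)) :
    σ p * (starRingEnd ℂ) (wig τ (tshift u g) (tshift z g) p) =
      bjKernel σ g z u τ (p - tfCenter τ z u) := by
  have := conj_wig_tshift g τ z u (p - tfCenter τ z u)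
  rw [sub_add_cancel] at this
  rw [this, bjKernel, sub_add_cancel]
  exact (mul_assoc _ _ _).symm

lemma continuous_bjKernel {σ : (Fin d → ℝ) × (Fin d → ℝ) → ℂ} (hσ : Continuous σ)
    (g : 𝓢(Fin d → ℝ, ℂ)) (z u : (Fin d → ℝ) × (Fin d → ℝ)) :
    Continuous fun x : ℝ × ((Fin d → ℝ) × (Fin d → ℝ)) => bjKernel σ g z u x.1 x.2 :=
  ((hσ.comp (continuous_snd.add ((continuous_tfCenter z u).comp continuous_fst))).mul
    (continuous_cexp_tfPhase z u)).mul (continuous_amb _ _)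

/-- The bound on the translated derivatives of a symbol of order `m`. -/
lemma SmSymbol.norm_iterate_pdir_le {m : ℝ} {σ : (Fin d → ℝ) × (Fin d → ℝ) → ℂ}
    (hσ : SmSymbol d m σ) {k N : ℕ} (hk : k ≤ N) (j : Fin d ⊕ Fin d) {τ : ℝ}
    (hτ : τ ∈ Set.Icc (0 : ℝ) 1) (z u q : (Fin d → ℝ) × (Fin d → ℝ)) :
    ‖(pdir (coordDir j))^[k] σ (q + tfCenter τ z u)‖ ≤
      smSeminorm d N m σ * (2 ^ |m| * 2 ^ |m| * jb2 z ^ m * jb2 (u - z) ^ ⌈|m|⌉₊) *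
        jb2 q ^ ⌈|m|⌉₊ := by
  rw [← mpd2_coordIndex, mul_assoc]
  refine (hσ.norm_mpd2_le ((sum_coordIndex k j).trans_le hk) _).trans ?_
  exact mul_le_mul_of_nonneg_left (jb2_add_tfCenter_rpow_le m hτ z u q) (smSeminorm_nonneg _ _ _)

lemma SmSymbol.norm_add_tfCenter_le {m : ℝ} {σ : (Fin d → ℝ) × (Fin d → ℝ) → ℂ}
    (hσ : SmSymbol d m σ) (N : ℕ) {τ : ℝ}
    (hτ : τ ∈ Set.Icc (0 : ℝ) 1) (z u q : (Fin d → ℝ) × (Fin d → ℝ)) :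
    ‖σ (q + tfCenter τ z u)‖ ≤
      smSeminorm d N m σ * (2 ^ |m| * 2 ^ |m| * jb2 z ^ m * jb2 (u - z) ^ ⌈|m|⌉₊) *
        jb2 q ^ ⌈|m|⌉₊ := by
  have h := hσ.norm_mpd2_le (N := N) (α := 0) (by simp) (q + tfCenter τ z u)
  have h₀ : mpd2 (0 : (Fin d → ℕ) × (Fin d → ℕ)) σ = σ := by
    simp [mpd2, stdList2, stdList_zero, mpdList]
  rw [h₀] at h
  rw [mul_assoc]
  exact h.trans (mul_le_mul_of_nonneg_left (jb2_add_tfCenter_rpow_le m hτ z u q)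
    (smSeminorm_nonneg _ _ _))

/-- Domination of the kernel, uniformly in `τ`. -/
lemma SmSymbol.bjKernel_dominated {m : ℝ} (g : 𝓢(Fin d → ℝ, ℂ)) :
    ∃ b : (Fin d → ℝ) × (Fin d → ℝ) → ℝ, Integrable b ∧ ∀ σ, SmSymbol d m σ →
      ∀ (N : ℕ) (z u), ∀ τ ∈ Set.Icc (0 : ℝ) 1,
        Integrable (bjKernel σ g z u τ) ∧ ∀ q, ‖bjKernel σ g z u τ q‖ ≤
          smSeminorm d N m σ * (2 ^ |m| * 2 ^ |m| * jb2 z ^ m * jb2 (u - z) ^ ⌈|m|⌉₊) * b q := by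
  obtain ⟨b, hb, h⟩ := (IsAmb.base (conjSchwartz g) g).exists_integrable_bound ⌈|m|⌉₊
  refine ⟨b, hb, fun σ hσ N z u τ hτ => ?_⟩
  have hz := jb2_pos z
  have hu := jb2_pos (u - z)
  have hS := smSeminorm_nonneg N m σ
  exact (IsAmb.base (conjSchwartz g) g).integrable_mul_mul hb (h τ hτ) (by positivity)
    (hσ.1.continuous.comp (by fun_prop))
    (Continuous.comp' (f := fun q => (τ, q)) (continuous_cexp_tfPhase z u) (by fun_prop))
    (hσ.norm_add_tfCenter_le N hτ z u) fun q => norm_cexp_two_pi_I _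

lemma SmSymbol.bjMatrix_eq {m : ℝ} {σ : (Fin d → ℝ) × (Fin d → ℝ) → ℂ} (hσ : SmSymbol d m σ)
    (g : 𝓢(Fin d → ℝ, ℂ)) (z u : (Fin d → ℝ) × (Fin d → ℝ)) :
    bjMatrix σ g z u = ∫ τ in (0 : ℝ)..1, ∫ q, bjKernel σ g z u τ q := by
  obtain ⟨b, hb, h⟩ := SmSymbol.bjKernel_dominated (m := m) g
  have h := h σ hσ 0 z u
  set B := smSeminorm d 0 m σ * (2 ^ |m| * 2 ^ |m| * jb2 z ^ m * jb2 (u - z) ^ ⌈|m|⌉₊)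
  have hcont : Continuous fun x : ℝ × ((Fin d → ℝ) × (Fin d → ℝ)) =>
      bjKernel σ g z u x.1 (x.2 - tfCenter x.1 z u) :=
    Continuous.comp' (f := fun x : ℝ × ((Fin d → ℝ) × (Fin d → ℝ)) =>
      (x.1, x.2 - tfCenter x.1 z u)) (continuous_bjKernel hσ.1.continuous g z u)
      (continuous_fst.prodMk
        (continuous_snd.sub ((continuous_tfCenter z u).comp continuous_fst)))
  have hint : Integrable (fun x : ℝ × ((Fin d → ℝ) × (Fin d → ℝ)) =>
      bjKernel σ g z u x.1 (x.2 - tfCenter x.1 z u))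
      ((volume.restrict (Set.Ioc (0 : ℝ) 1)).prod volume) := by
    have hmeas := hcont.aestronglyMeasurable
      (μ := (volume.restrict (Set.Ioc (0 : ℝ) 1)).prod volume)
    refine (integrable_prod_iff hmeas).2 ⟨?_, ?_⟩
    · filter_upwards [ae_restrict_mem measurableSet_Ioc] with τ hτ
      exact (h τ (Set.Ioc_subset_Icc_self hτ)).1.comp_sub_right (tfCenter τ z u)
    · refine Integrable.of_bound (C := B * ∫ q, b q) hmeas.norm.integral_prod_right' ?_
      filter_upwards [ae_restrict_mem measurableSet_Ioc] with τ hτ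
      obtain ⟨-, hle⟩ := h τ (Set.Ioc_subset_Icc_self hτ)
      rw [integral_sub_right_eq_self (fun q => ‖bjKernel σ g z u τ q‖) (tfCenter τ z u)]
      rw [← integral_const_mul]
      exact norm_integral_le_of_norm_le (hb.const_mul B) (.of_forall fun q => by
        rw [norm_norm]
        exact hle q)
  rw [intervalIntegral.integral_of_le zero_le_one]
  calc bjMatrix σ g z u
      = ∫ p, ∫ τ in Set.Ioc (0 : ℝ) 1, bjKernel σ g z u τ (p - tfCenter τ z u) := by
        rw [bjMatrix]
        congr 1 with p
        rw [intervalIntegral.integral_of_le zero_le_one, ← integral_conj, ← integral_const_mul]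
        simp only [mul_conj_wig_tshift]
    _ = ∫ τ in Set.Ioc (0 : ℝ) 1, ∫ p, bjKernel σ g z u τ (p - tfCenter τ z u) :=
        (integral_integral_swap hint).symm
    _ = _ := by
        congr 1 with τ
        exact integral_sub_right_eq_self (bjKernel σ g z u τ) (tfCenter τ z u)

lemma SmSymbol.exists_norm_integral_bjKernel_le (m : ℝ) (g : 𝓢(Fin d → ℝ, ℂ)) (N : ℕ) :
    ∃ C, 0 ≤ C ∧ ∀ σ, SmSymbol d m σ → ∀ (K : ℕ), N ≤ K → ∀ z u, ∀ τ ∈ Set.Icc (0 : ℝ) 1,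
      jb2 (u - z) ^ N * ‖∫ q, bjKernel σ g z u τ q‖ ≤ C *
        (smSeminorm d K m σ * (2 ^ |m| * 2 ^ |m| * jb2 z ^ m * jb2 (u - z) ^ ⌈|m|⌉₊)) := by
  obtain ⟨b, hb, h⟩ := SmSymbol.bjKernel_dominated (m := m) g
  choose C hC₀ hC using fun j =>
    (IsAmb.base (conjSchwartz g) g).oscillatory_bound j ⌈|m|⌉₊ N
  have hCs : 0 ≤ ∑ j, C j := Finset.sum_nonneg fun j _ => hC₀ j
  refine ⟨(2 * d + 1) ^ N * (|∫ q, b q| + ∑ j, C j), by positivity,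
    fun σ hσ K hK z u τ hτ => ?_⟩
  have hz := jb2_pos z
  have hu := jb2_pos (u - z)
  have hS := smSeminorm_nonneg K m σ
  obtain ⟨-, hle⟩ := h σ hσ K z u τ hτ
  have hsB := fun k (hk : k ≤ N) j q => hσ.norm_iterate_pdir_le (hk.trans hK) j hτ z u q
  have hB : 0 ≤ smSeminorm d K m σ *
    (2 ^ |m| * 2 ^ |m| * jb2 z ^ m * jb2 (u - z) ^ ⌈|m|⌉₊) := by positivity
  set B := smSeminorm d K m σ * (2 ^ |m| * 2 ^ |m| * jb2 z ^ m * jb2 (u - z) ^ ⌈|m|⌉₊)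
  rw [mul_assoc]
  refine jb2_pow_mul_le (norm_nonneg _) ?_ fun j => ?_
  · have := norm_integral_le_of_norm_le (hb.const_mul B) (.of_forall hle)
    rw [integral_const_mul, mul_comm] at this
    refine this.trans (mul_le_mul_of_nonneg_right ?_ hB)
    linarith [le_abs_self (∫ q, b q)]
  · obtain ⟨κ, hκ, hd⟩ := hasLineDerivAt_cexp_tfPhase τ z u j.swap
    rw [Sum.swap_swap] at hκ
    have hs (k : ℕ) (p : (Fin d → ℝ) × (Fin d → ℝ)) : HasLineDerivAt ℝ
        (fun q => (pdir (coordDir j.swap))^[k] σ (q + tfCenter τ z u))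
        ((pdir (coordDir j.swap))^[k + 1] σ (p + tfCenter τ z u)) p (coordDir j.swap) := by
      have := hasLineDerivAt_iterate_pdir hσ.1 (coordDir j.swap) k (p + tfCenter τ z u)
      unfold HasLineDerivAt at this ⊢
      simpa only [add_right_comm] using this
    have := hC j.swap τ hτ
      (fun k q => (pdir (coordDir j.swap))^[k] σ (q + tfCenter τ z u)) B hB
      (fun k => (contDiff_iterate_pdir hσ.1 _ k).continuous.comp (by fun_prop)) hs
      (fun k hk q => hsB k hk _ q) (fun q => cexp (2 * π * I * (tfPhase τ z u q : ℝ))) κ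
      (Continuous.comp' (f := fun q => (τ, q)) (continuous_cexp_tfPhase z u) (by fun_prop))
      (fun q => norm_cexp_two_pi_I _) hd
    calc |coordVal (u - z) j| ^ N * ‖∫ q, bjKernel σ g z u τ q‖
        ≤ ‖κ‖ ^ N * ‖∫ q, bjKernel σ g z u τ q‖ := by gcongr
      _ ≤ C j.swap * B := this
      _ ≤ _ := by
        refine mul_le_mul_of_nonneg_right ?_ hB
        have := Finset.single_le_sum (fun j _ => hC₀ j) (Finset.mem_univ j.swap)
        linarith [abs_nonneg (∫ q, b q)]

/-- Gabor matrix decay for Born–Jordan operators with symbols in `S^m`: for every `n`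
there is `C > 0`, independent of `σ`, with
`|⟨Op_{BJ}(σ)π(z)g, π(u)g⟩| ≤ C |σ|_{n+⌈|m|⌉+2d+1, m} ⟨z⟩^m ⟨u-z⟩^{-n}`. -/
theorem bj_gabor_matrix_decay (d : ℕ) (m : ℝ) (g : SchwartzMap (Fin d → ℝ) ℂ)
    (hg : g ≠ 0) (n : ℕ) :
    ∃ C > 0, ∀ σ : (Fin d → ℝ) × (Fin d → ℝ) → ℂ, SmSymbol d m σ →
      ∀ z u : (Fin d → ℝ) × (Fin d → ℝ),
        ‖bjMatrix σ (⇑g) z u‖ ≤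
          C * smSeminorm d (n + ⌈|m|⌉₊ + 2 * d + 1) m σ *
            (jb2 z ^ m * jb2 (u - z) ^ (-(n : ℝ))) := by
  obtain ⟨C, hC, h⟩ := SmSymbol.exists_norm_integral_bjKernel_le m g (n + ⌈|m|⌉₊)
  refine ⟨C * (2 ^ |m| * 2 ^ |m|) + 1, by positivity, fun σ hσ z u => ?_⟩
  have hz := jb2_pos z
  have hu := jb2_pos (u - z)
  have hS := smSeminorm_nonneg (n + ⌈|m|⌉₊ + 2 * d + 1) m σ
  have h := h σ hσ (n + ⌈|m|⌉₊ + 2 * d + 1) (by omega) z u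
  set S := smSeminorm d (n + ⌈|m|⌉₊ + 2 * d + 1) m σ
  have key : ∀ τ ∈ Set.uIoc (0 : ℝ) 1, ‖∫ q, bjKernel σ g z u τ q‖ ≤
      C * (2 ^ |m| * 2 ^ |m|) * S * (jb2 z ^ m * jb2 (u - z) ^ (-(n : ℝ))) := by
    intro τ hτ
    rw [Set.uIoc_of_le zero_le_one] at hτ
    have := h τ (Set.Ioc_subset_Icc_self hτ)
    rw [mul_comm, ← le_div_iff₀ (by positivity)] at this
    refine this.trans_eq ?_
    rw [Real.rpow_neg hu.le, Real.rpow_natCast, pow_add]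
    field_simp
  rw [hσ.bjMatrix_eq]
  have := intervalIntegral.norm_integral_le_of_norm_le_const key
  rw [sub_zero, abs_one, mul_one] at this
  refine this.trans ?_
  gcongr
  exact le_add_of_nonneg_right zero_le_one
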